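/- arXiv:2407.06905 — 2 statements merged into one kernel-verified Lean document; each statement's English description precedes it below -/
import Mathlib

section
/- Let α ∈ (0,3). There exists a constant A = A_{H,L}(α) > 0 such that for every μ > 0, ξ ∈ ℝ³, and x ∈ ℝ³, A · (∫_{ℝ³} w_{μ,ξ}(y)^{6−α} |x−y|^{−α} dy) · w_{μ,ξ}(x)^{5−α} = w_{μ,ξ}(x)⁵; equivalently, ∫_{ℝ³} w_{μ,ξ}(y)^{6−α} |x−y|^{−α} dy = A^{−1} w_{μ,ξ}(x)^{α} for all x, so that w_{μ,ξ} solves −Δw_{μ,ξ} = A (∫_{ℝ³} w_{μ,ξ}(y)^{6−α} |x−y|^{−α} dy) w_{μ,ξ}^{5−α} on ℝ³. -/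
open MeasureTheory Set Filter

noncomputable section

/-- `ℝ³` as a Euclidean space. -/
abbrev E3 : Type := EuclideanSpace ℝ (Fin 3)

/-- The Laplacian of `f : ℝ³ → ℝ`, as the sum of the second partial derivatives. -/
noncomputable def lap (f : E3 → ℝ) (x : E3) : ℝ :=
  ∑ i : Fin 3,
    fderiv ℝ (fun y => fderiv ℝ f y (EuclideanSpace.single i 1)) x (EuclideanSpace.single i 1)

/-- The standard bubble `w_{μ,ξ}(x) = 3^{1/4} (μ/(μ² + |x−ξ|²))^{1/2}`. -/
noncomputable def bubble (μ : ℝ) (ξ x : E3) : ℝ :=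
  (3 : ℝ) ^ ((1 : ℝ)/4) * (μ / (μ ^ 2 + ‖x - ξ‖ ^ 2)) ^ ((1 : ℝ)/2)

lemma integral_inversion_E3 (g : E3 → ℝ) :
    ∫ y, g y = ∫ z : E3, (‖z‖ ^ 6)⁻¹ * g ((1 / ‖z‖) ^ 2 • z) := by
  have hinj : InjOn (EuclideanGeometry.inversion (0 : E3) 1) {0}ᶜ :=
    (EuclideanGeometry.inversion_injective (0 : E3) one_ne_zero).injOn
  have himg : EuclideanGeometry.inversion (0 : E3) 1 '' {0}ᶜ = {0}ᶜ := by
    rw [Set.image_compl_eq (EuclideanGeometry.inversion_bijective (0 : E3) one_ne_zero)]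
    simp
  have h := integral_image_eq_integral_abs_det_fderiv_smul (volume : Measure E3)
    (s := {0}ᶜ) (MeasurableSet.singleton (0 : E3)).compl
    (fun x hx => (EuclideanGeometry.hasFDerivAt_inversion (R := 1) (c := (0 : E3))
      (x := x) hx).hasFDerivWithinAt) hinj g
  rw [himg] at h
  have hr : (volume : Measure E3).restrict {0}ᶜ = volume :=
    Measure.restrict_eq_self_of_ae_mem (by
      rw [ae_iff]; simp)
  rw [hr] at h
  rw [h]
  congr 1
  ext z
  have hdet : |(((1 / dist z 0) ^ 2 • ((Submodule.span ℝ {z - 0})ᗮ.reflection : E3 →L[ℝ] E3)) :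
      E3 →L[ℝ] E3).det| = (‖z‖ ^ 6)⁻¹ := by
    have h1 := Submodule.det_reflection ((Submodule.span ℝ {z - 0})ᗮ)
    have : (((1 / dist z 0) ^ 2 • ((Submodule.span ℝ {z - 0})ᗮ.reflection : E3 →L[ℝ] E3)) :
      E3 →L[ℝ] E3).det = ((1 / dist z 0) ^ 2) ^ 3 *
        LinearMap.det ((Submodule.span ℝ {z - 0})ᗮ.reflection.toLinearMap) := by
      have := LinearMap.det_smul ((1 / dist z 0) ^ 2)
        ((Submodule.span ℝ {z - 0})ᗮ.reflection.toLinearMap : E3 →ₗ[ℝ] E3)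
      rw [finrank_euclideanSpace_fin] at this
      exact this
    rw [this, h1, abs_mul, abs_pow (-1 : ℝ)]
    simp [← pow_mul]
  rw [hdet]
  simp [EuclideanGeometry.inversion]

lemma norm_key (μ : ℝ) (hμ : 0 < μ) (p z : E3) (hz : z ≠ 0) :
    μ ^ 2 + ‖(1 / ‖z‖) ^ 2 • z - p‖ ^ 2 =
      (‖z‖ ^ 2)⁻¹ * (μ ^ 2 / (μ ^ 2 + ‖p‖ ^ 2)) *
        (1 + ‖((μ ^ 2 + ‖p‖ ^ 2) / μ) • (z - (μ ^ 2 + ‖p‖ ^ 2)⁻¹ • p)‖ ^ 2) := by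
  have hz' : ‖z‖ ≠ 0 := norm_ne_zero_iff.mpr hz
  have hS : μ ^ 2 + ‖p‖ ^ 2 ≠ 0 := by positivity
  rw [norm_smul, mul_pow, norm_sub_sq_real, norm_sub_sq_real, norm_smul, norm_smul,
    real_inner_smul_left, real_inner_smul_right]
  simp only [mul_pow, Real.norm_eq_abs, sq_abs]
  field_simp
  ring

lemma core (α μ : ℝ) (hμ : 0 < μ) (p : E3) :
    ∫ y : E3, (μ / (μ ^ 2 + ‖y - p‖ ^ 2)) ^ ((6 - α) / 2) / ‖y‖ ^ α =
      (μ / (μ ^ 2 + ‖p‖ ^ 2)) ^ (α / 2) * ∫ u : E3, (1 + ‖u‖ ^ 2) ^ (-(6 - α) / 2) := by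
  rw [integral_inversion_E3]
  set S := μ ^ 2 + ‖p‖ ^ 2 with hSdef
  have hS : 0 < S := by positivity
  have ht : 0 < S / μ := by positivity
  have hae : ∀ᵐ z : E3, (‖z‖ ^ 6)⁻¹ * ((μ / (μ ^ 2 + ‖(1 / ‖z‖) ^ 2 • z - p‖ ^ 2)) ^ ((6 - α) / 2)
      / ‖(1 / ‖z‖) ^ 2 • z‖ ^ α) =
      (S / μ) ^ ((6 - α) / 2) *
        (fun u : E3 => (1 + ‖u‖ ^ 2) ^ (-(6 - α) / 2)) ((S / μ) • (z - S⁻¹ • p)) := by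
    have h0 : ∀ᵐ z : E3, z ≠ 0 := by rw [ae_iff]; simp
    filter_upwards [h0] with z hz
    have hz' : 0 < ‖z‖ := norm_pos_iff.mpr hz
    rw [norm_key μ hμ p z hz]
    rw [← hSdef]
    beta_reduce
    set N := 1 + ‖(S / μ) • (z - S⁻¹ • p)‖ ^ 2 with hN
    have hNpos : 0 < N := by positivity
    have e1 : ‖(1 / ‖z‖) ^ 2 • z‖ = ‖z‖⁻¹ := by
      rw [norm_smul]; simp; field_simp
    have e2 : μ / ((‖z‖ ^ 2)⁻¹ * (μ ^ 2 / S) * N) = ‖z‖ ^ 2 * ((S / μ) * N⁻¹) := by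
      field_simp
    rw [e1, e2, Real.mul_rpow (by positivity) (by positivity),
      Real.mul_rpow (by positivity) (by positivity), Real.inv_rpow hz'.le,
      Real.inv_rpow hNpos.le, neg_div, Real.rpow_neg hNpos.le,
      ← Real.rpow_natCast ‖z‖ 2, ← Real.rpow_mul hz'.le, ← Real.rpow_natCast ‖z‖ 6]
    have e3 : ((2 : ℕ) : ℝ) * ((6 - α) / 2) = (6 : ℕ) - α := by push_cast; ring
    rw [e3, Real.rpow_sub hz']
    have : ‖z‖ ^ α ≠ 0 := by positivity
    have : ‖z‖ ^ ((6 : ℕ) : ℝ) ≠ 0 := by positivity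
    field_simp
  rw [integral_congr_ae hae, integral_const_mul,
    integral_sub_right_eq_self (fun z : E3 => (fun u : E3 => (1 + ‖u‖ ^ 2) ^ (-(6 - α) / 2))
      ((S / μ) • z)) (S⁻¹ • p),
    Measure.integral_comp_smul volume (fun u : E3 => (1 + ‖u‖ ^ 2) ^ (-(6 - α) / 2)) (S / μ),
    finrank_euclideanSpace_fin, abs_of_pos (by positivity),
    smul_eq_mul, ← mul_assoc]
  congr 1
  rw [← inv_div S μ, Real.inv_rpow ht.le, ← Real.rpow_natCast, ← Real.rpow_neg ht.le,
    ← Real.rpow_neg ht.le, ← Real.rpow_add ht]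
  congr 1
  push_cast
  ring

lemma C0_pos (α : ℝ) (hα : α < 3) : 0 < ∫ u : E3, (1 + ‖u‖ ^ 2) ^ (-(6 - α) / 2) := by
  have hi : Integrable (fun u : E3 => (1 + ‖u‖ ^ 2) ^ (-(6 - α) / 2)) :=
    integrable_rpow_neg_one_add_norm_sq (by rw [finrank_euclideanSpace_fin]; norm_num; linarith)
  rw [integral_pos_iff_support_of_nonneg (fun u => by positivity) hi]
  have : Function.support (fun u : E3 => (1 + ‖u‖ ^ 2) ^ (-(6 - α) / 2)) = Set.univ := by
    ext u
    simp only [Function.mem_support, Set.mem_univ, iff_true]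
    positivity
  rw [this]
  exact isOpen_univ.measure_pos volume Set.univ_nonempty

lemma bubble_pos (μ : ℝ) (hμ : 0 < μ) (ξ x : E3) : 0 < bubble μ ξ x := by
  unfold bubble
  positivity

lemma bubble_rpow (μ : ℝ) (hμ : 0 < μ) (ξ x : E3) (r : ℝ) :
    bubble μ ξ x ^ r = 3 ^ (r / 4) * (μ / (μ ^ 2 + ‖x - ξ‖ ^ 2)) ^ (r / 2) := by
  unfold bubble
  rw [Real.mul_rpow (by positivity) (by positivity), ← Real.rpow_mul (by positivity),
    ← Real.rpow_mul (by positivity)]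
  congr 2 <;> ring

lemma integral_bubble (α μ : ℝ) (hμ : 0 < μ) (ξ x : E3) :
    ∫ y : E3, (bubble μ ξ y) ^ (6 - α) / ‖x - y‖ ^ α =
      (3 ^ ((6 - α) / 4) * ∫ u : E3, (1 + ‖u‖ ^ 2) ^ (-(6 - α) / 2)) / 3 ^ (α / 4) *
        (bubble μ ξ x) ^ α := by
  have h1 := integral_add_right_eq_self (μ := (volume : Measure E3))
    (fun y : E3 => (bubble μ ξ y) ^ (6 - α) / ‖x - y‖ ^ α) x
  rw [← h1]
  have h2 : ∀ y : E3, (bubble μ ξ (y + x)) ^ (6 - α) / ‖x - (y + x)‖ ^ α =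
      3 ^ ((6 - α) / 4) * ((μ / (μ ^ 2 + ‖y - (ξ - x)‖ ^ 2)) ^ ((6 - α) / 2) / ‖y‖ ^ α) := by
    intro y
    rw [bubble_rpow μ hμ, show x - (y + x) = -y by abel, norm_neg,
      show y + x - ξ = y - (ξ - x) by abel, mul_div_assoc]
  simp only [h2]
  rw [integral_const_mul, core α μ hμ, bubble_rpow μ hμ, norm_sub_rev ξ x]
  have : (3 : ℝ) ^ (α / 4) ≠ 0 := by positivity
  field_simp

lemma hasFDerivAt_Q (μ : ℝ) (hμ : 0 < μ) (ξ y : E3) (r : ℝ) :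
    HasFDerivAt (fun y : E3 => (μ ^ 2 + ‖y - ξ‖ ^ 2) ^ r)
      ((r * (μ ^ 2 + ‖y - ξ‖ ^ 2) ^ (r - 1)) • ((2 : ℝ) • innerSL ℝ (y - ξ))) y := by
  have h1 : HasFDerivAt (fun y : E3 => μ ^ 2 + ‖y - ξ‖ ^ 2) ((2 : ℝ) • innerSL ℝ (y - ξ)) y := by
    have := (((hasFDerivAt_id (𝕜 := ℝ) y).sub_const ξ).norm_sq).const_add (μ ^ 2)
    refine this.congr_fderiv ?_
    ext v
    simp [two_mul]
  exact h1.rpow_const (Or.inl (by positivity))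

lemma bubble_eq (μ : ℝ) (hμ : 0 < μ) (ξ : E3) :
    bubble μ ξ = fun y => (3 ^ ((1 : ℝ) / 4) * μ ^ ((1 : ℝ) / 2)) *
      (μ ^ 2 + ‖y - ξ‖ ^ 2) ^ (-(1 : ℝ) / 2) := by
  ext y
  unfold bubble
  rw [Real.div_rpow hμ.le (by positivity), neg_div, Real.rpow_neg (by positivity)]
  ring

lemma lap_bubble (μ : ℝ) (hμ : 0 < μ) (ξ x : E3) :
    -(lap (bubble μ ξ) x) = bubble μ ξ x ^ 5 := by
  have hf : ∀ i : Fin 3, (fun y => fderiv ℝ (bubble μ ξ) y (EuclideanSpace.single i 1)) =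
      fun y => (-(3 ^ ((1 : ℝ) / 4) * μ ^ ((1 : ℝ) / 2))) *
        ((μ ^ 2 + ‖y - ξ‖ ^ 2) ^ (-(3 : ℝ) / 2) * (y - ξ) i) := by
    intro i
    ext y
    rw [bubble_eq μ hμ, ((hasFDerivAt_Q μ hμ ξ y _).const_mul _).fderiv]
    simp [EuclideanSpace.inner_single_right]
    rw [show (-1 / 2 - 1 : ℝ) = -3 / 2 by norm_num]
    ring
  have hQ : 0 < μ ^ 2 + ‖x - ξ‖ ^ 2 := by positivity
  have hd : ∀ i : Fin 3, fderiv ℝ (fun y => fderiv ℝ (bubble μ ξ) y (EuclideanSpace.single i 1)) x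
      (EuclideanSpace.single i 1) = (-(3 ^ ((1 : ℝ) / 4) * μ ^ ((1 : ℝ) / 2))) *
        ((μ ^ 2 + ‖x - ξ‖ ^ 2) ^ (-(3 : ℝ) / 2)
          - 3 * (μ ^ 2 + ‖x - ξ‖ ^ 2) ^ (-(5 : ℝ) / 2) * ((x - ξ) i) ^ 2) := by
    intro i
    rw [hf i]
    have hc : HasFDerivAt (fun y : E3 => (y - ξ) i) (EuclideanSpace.proj i : E3 →L[ℝ] ℝ) x := by
      have := (EuclideanSpace.proj i : E3 →L[ℝ] ℝ).hasFDerivAt.comp x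
        ((hasFDerivAt_id (𝕜 := ℝ) x).sub_const ξ)
      exact this
    have hm := (((hasFDerivAt_Q μ hμ ξ x (-(3 : ℝ) / 2)).mul hc).const_mul
      (-(3 ^ ((1 : ℝ) / 4) * μ ^ ((1 : ℝ) / 2)))).fderiv
    simp only [Pi.mul_apply] at hm
    rw [hm]
    simp [EuclideanSpace.inner_single_right]
    rw [show (-3 / 2 - 1 : ℝ) = -5 / 2 by norm_num]
    ring
  unfold lap
  simp only [hd]
  have hn : ‖x - ξ‖ ^ 2 = ∑ i, ((x - ξ) i) ^ 2 := by
    rw [EuclideanSpace.norm_sq_eq]; simp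
  rw [← Finset.mul_sum, Finset.sum_sub_distrib, ← Finset.mul_sum, ← hn]
  have h5 : bubble μ ξ x ^ 5 = bubble μ ξ x ^ (5 : ℝ) := by
    rw [← Real.rpow_natCast]; norm_num
  rw [h5, bubble_rpow μ hμ, Real.div_rpow hμ.le hQ.le]
  set Q := μ ^ 2 + ‖x - ξ‖ ^ 2 with hQd
  have hx : ‖x - ξ‖ ^ 2 = Q - μ ^ 2 := by rw [hQd]; ring
  rw [hx]
  have a1 : Q ^ (-(3 : ℝ) / 2) = Q ^ (-(5 : ℝ) / 2) * Q := by
    rw [← Real.rpow_add_one hQ.ne']; norm_num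
  have a2 : Q ^ (-(5 : ℝ) / 2) = (Q ^ ((5 : ℝ) / 2))⁻¹ := by
    rw [neg_div, Real.rpow_neg hQ.le]
  have a3 : (3 : ℝ) ^ ((5 : ℝ) / 4) = 3 ^ ((1 : ℝ) / 4) * 3 := by
    rw [← Real.rpow_add_one (by norm_num)]; norm_num
  have a4 : μ ^ ((5 : ℝ) / 2) = μ ^ ((1 : ℝ) / 2) * μ ^ 2 := by
    rw [← Real.rpow_natCast μ 2, ← Real.rpow_add hμ]; norm_num
  rw [a1, a2, a3, a4]
  simp
  ring

/-- let `α ∈ (0,3)`. There is a constant `A = A_{H,L}(α) > 0` such that for every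
`μ > 0`, `ξ, x ∈ ℝ³`:
`A (∫ w_{μ,ξ}(y)^{6−α}|x−y|^{−α} dy) w_{μ,ξ}(x)^{5−α} = w_{μ,ξ}(x)⁵`; equivalently
`∫ w_{μ,ξ}(y)^{6−α}|x−y|^{−α} dy = A⁻¹ w_{μ,ξ}(x)^α`, so that `w_{μ,ξ}` solves
`−Δw_{μ,ξ} = A (∫ w_{μ,ξ}^{6−α}|x−y|^{−α} dy) w_{μ,ξ}^{5−α}` on ℝ³. -/
theorem bubble_solves_choquard (α : ℝ) (hα : α ∈ Set.Ioo (0 : ℝ) 3) :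
    ∃ A > 0, ∀ μ : ℝ, 0 < μ → ∀ ξ x : E3,
      A * (∫ y : E3, (bubble μ ξ y) ^ (6 - α) / ‖x - y‖ ^ α) * (bubble μ ξ x) ^ (5 - α)
          = (bubble μ ξ x) ^ 5 ∧
      (∫ y : E3, (bubble μ ξ y) ^ (6 - α) / ‖x - y‖ ^ α) = A⁻¹ * (bubble μ ξ x) ^ α ∧
      -(lap (bubble μ ξ) x) =
        A * (∫ y : E3, (bubble μ ξ y) ^ (6 - α) / ‖x - y‖ ^ α) * (bubble μ ξ x) ^ (5 - α) := by
  have hC := C0_pos α hα.2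
  have hA : 0 < (3 ^ ((6 - α) / 4) * ∫ u : E3, (1 + ‖u‖ ^ 2) ^ (-(6 - α) / 2)) /
      (3 : ℝ) ^ (α / 4) := by positivity
  refine ⟨_, inv_pos.mpr hA, fun μ hμ ξ x => ?_⟩
  have hI := integral_bubble α μ hμ ξ x
  have hb := bubble_pos μ hμ ξ x
  have h1 : ((3 ^ ((6 - α) / 4) * ∫ u : E3, (1 + ‖u‖ ^ 2) ^ (-(6 - α) / 2)) /
      (3 : ℝ) ^ (α / 4))⁻¹ * (∫ y : E3, (bubble μ ξ y) ^ (6 - α) / ‖x - y‖ ^ α) *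
        (bubble μ ξ x) ^ (5 - α) = (bubble μ ξ x) ^ 5 := by
    rw [hI, inv_mul_cancel_left₀ hA.ne', ← Real.rpow_add hb, ← Real.rpow_natCast]
    congr 1
    push_cast
    ring
  refine ⟨h1, ?_, ?_⟩
  · rw [inv_inv]; exact hI
  · rw [h1]; exact lap_bubble μ hμ ξ x

end
end

section
/- Let α ∈ (0,3) and δ > 0. There exists a constant C = C(α, δ) > 0 such that for every open set Ω ⊆ ℝ³, every ξ ∈ ℝ³ with the ball B(ξ, δ) ⊆ Ω, every μ ∈ (0,1], and every smooth compactly supported function φ : ℝ³ → ℝ, |∫_Ω ∫_{ℝ³∖Ω} w_{μ,ξ}(y)^{6−α} w_{μ,ξ}(x)^{5−α} φ(x) |x−y|^{−α} dy dx| ≤ C μ^{(6−α)/2} (∫_{ℝ³} |∇φ|² dx)^{1/2}. -/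
open MeasureTheory Set Filter

noncomputable section

/-- radial profile -/
def prof (a b t : ℝ) : ℝ := if t < 1 then t ^ (-a) else t ^ (-b)

lemma prof_nonneg (a b : ℝ) {t : ℝ} (ht : 0 ≤ t) : 0 ≤ prof a b t := by
  unfold prof; split_ifs <;> positivity

lemma prof_meas (a b : ℝ) : Measurable (prof a b) := by
  unfold prof
  exact Measurable.ite measurableSet_Iio (by fun_prop) (by fun_prop)

lemma prof_integrable {a b : ℝ} (ha : a < 3) (hb : 3 < b) :
    Integrable (fun z : E3 => prof a b ‖z‖) := by
  rw [integrable_fun_norm_addHaar (μ := (volume : Measure E3)) (f := prof a b)]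
  have h3 : Module.finrank ℝ E3 - 1 = 2 := by simp
  rw [h3, ← Ioo_union_Ici_eq_Ioi (zero_lt_one : (0:ℝ) < 1)]
  apply IntegrableOn.union
  · refine IntegrableOn.congr_fun (f := fun t : ℝ => t ^ (2 - a)) ?_ ?_ measurableSet_Ioo
    · exact (intervalIntegral.integrableOn_Ioo_rpow_iff zero_lt_one).2 (by linarith)
    · intro t ht
      simp only [prof, ht.2, if_true, smul_eq_mul]
      rw [← Real.rpow_natCast, ← Real.rpow_add ht.1]
      norm_num [sub_eq_add_neg]
  · rw [integrableOn_Ici_iff_integrableOn_Ioi]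
    refine IntegrableOn.congr_fun (f := fun t : ℝ => t ^ (2 - b)) ?_ ?_ measurableSet_Ioi
    · exact (integrableOn_Ioi_rpow_iff zero_lt_one).2 (by linarith)
    · intro t ht
      have ht' : (1:ℝ) < t := ht
      simp only [prof, not_lt.2 ht'.le, if_false, smul_eq_mul]
      rw [← Real.rpow_natCast, ← Real.rpow_add (by linarith)]
      norm_num [sub_eq_add_neg]

lemma sobolev6 : ∃ C : ℝ, 0 ≤ C ∧ ∀ φ : E3 → ℝ, ContDiff ℝ (⊤ : ℕ∞) φ → HasCompactSupport φ →
    (∫ x, |φ x| ^ (6:ℝ)) ^ (1 / (6:ℝ)) ≤ C * (∫ x : E3, ‖fderiv ℝ φ x‖ ^ 2) ^ ((1 : ℝ)/2) := by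
  refine ⟨(SNormLESNormFDerivOfEqConst ℝ (volume : Measure E3) 2 : NNReal), NNReal.coe_nonneg _, ?_⟩
  intro φ hφ hc
  have h1 : ContDiff ℝ 1 φ := hφ.of_le (by exact_mod_cast le_top)
  have key := eLpNorm_le_eLpNorm_fderiv_of_eq (volume : Measure E3) h1 hc (p := 2) (p' := 6)
    (by norm_num) (by simp) (by simp; norm_num)
  have m6 : MemLp φ 6 (volume : Measure E3) := h1.continuous.memLp_of_hasCompactSupport hc
  have m2 : MemLp (fderiv ℝ φ) 2 (volume : Measure E3) :=
    (h1.continuous_fderiv one_ne_zero).memLp_of_hasCompactSupport (hc.fderiv ℝ)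
  have e6 := m6.eLpNorm_eq_integral_rpow_norm (by norm_num) (by norm_num)
  have e2 := m2.eLpNorm_eq_integral_rpow_norm (by norm_num) (by norm_num)
  have c6 : ((6 : NNReal) : ENNReal) = 6 := by norm_num
  have c2 : ((2 : NNReal) : ENNReal) = 2 := by norm_num
  rw [c6, c2, e6, e2, ← ENNReal.ofReal_coe_nnreal, ← ENNReal.ofReal_mul (NNReal.coe_nonneg _),
    ENNReal.ofReal_le_ofReal_iff (by positivity)] at key
  simpa using key

/-- pointwise kernel bound -/
lemma kernel_bound {α δ r ρ d : ℝ} (hα0 : 0 < α) (hα : α < 3) (hδ : 0 < δ) (hδ1 : δ ≤ 1)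
    (hr : 0 ≤ r) (hρ : δ ≤ ρ) (hd : 0 ≤ d) (htri : r ≤ ρ + d) :
    ρ ^ (-(6 - α)) * d ^ (-α) ≤
      (2 ^ (6 - α) * δ ^ (-(6 - α))) * prof 0 α r * (prof α (6 - α) d + prof α (6 - α) ρ) := by
  set β := 6 - α with hβ
  have hρ0 : 0 < ρ := by linarith
  have h2 : (1:ℝ) ≤ 2 ^ β := Real.one_le_rpow (by norm_num) (by linarith)
  have hD : (1:ℝ) ≤ δ ^ (-β) :=
    Real.one_le_rpow_of_pos_of_le_one_of_nonpos hδ hδ1 (by linarith)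
  have hpd : 0 ≤ prof α β d := prof_nonneg _ _ hd
  have hpρ : 0 ≤ prof α β ρ := prof_nonneg _ _ hρ0.le
  have hρδ : ρ ^ (-β) ≤ δ ^ (-β) := Real.rpow_le_rpow_of_nonpos hδ hρ (by linarith)
  have hρh : ρ ^ (-β) ≤ δ ^ (-β) * prof α β ρ := by
    unfold prof; split_ifs with h
    · have : 1 ≤ ρ ^ (-α) := Real.one_le_rpow_of_pos_of_le_one_of_nonpos hρ0 h.le (by linarith)
      nlinarith
    · have : 0 < ρ ^ (-β) := by positivity
      nlinarith
  have hρn : 0 ≤ ρ ^ (-β) := by positivity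
  have hdn : 0 ≤ d ^ (-α) := by positivity
  set D := δ ^ (-β)
  set T := (2:ℝ) ^ β with hT
  by_cases hr1 : r < 1
  · have hm : prof 0 α r = 1 := by simp [prof, hr1]
    rw [hm, mul_one]
    have main : ρ ^ (-β) * d ^ (-α) ≤ D * (prof α β d + prof α β ρ) := by
      by_cases hd1 : d < 1
      · have : prof α β d = d ^ (-α) := by simp [prof, hd1]
        rw [this]
        have := mul_le_mul_of_nonneg_right hρδ hdn
        have : 0 ≤ D * prof α β ρ := by positivity
        nlinarith
      · have : d ^ (-α) ≤ 1 := Real.rpow_le_one_of_one_le_of_nonpos (not_lt.1 hd1) (by linarith)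
        have := mul_le_mul_of_nonneg_left this hρn
        have : 0 ≤ D * prof α β d := by positivity
        nlinarith
    have h0 : 0 ≤ D * (prof α β d + prof α β ρ) := by positivity
    nlinarith
  · have hm : prof 0 α r = r ^ (-α) := by simp [prof, hr1]
    rw [hm]
    have hr1' : 1 ≤ r := not_lt.1 hr1
    have hr0 : 0 < r := by linarith
    have hrn : 0 ≤ r ^ (-α) := by positivity
    have half : ∀ s : ℝ, (r / 2) ^ (-s) = 2 ^ s * r ^ (-s) := by
      intro s
      rw [Real.div_rpow hr0.le (by norm_num), Real.rpow_neg (by norm_num : (0:ℝ) ≤ 2)]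
      field_simp
    by_cases hdr : r / 2 ≤ d
    · have h1 : d ^ (-α) ≤ (r / 2) ^ (-α) :=
        Real.rpow_le_rpow_of_nonpos (by linarith) hdr (by linarith)
      rw [half] at h1
      have h2' : (2:ℝ) ^ α ≤ T := Real.rpow_le_rpow_of_exponent_le (by norm_num) (by linarith)
      have h3 : d ^ (-α) ≤ T * r ^ (-α) := h1.trans (mul_le_mul_of_nonneg_right h2' hrn)
      calc ρ ^ (-β) * d ^ (-α) ≤ (D * prof α β ρ) * (T * r ^ (-α)) :=
            mul_le_mul hρh h3 hdn (by positivity)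
        _ ≤ T * D * r ^ (-α) * (prof α β d + prof α β ρ) := by
            have : 0 ≤ T * D * r ^ (-α) * prof α β d := by positivity
            linarith
    · have hdr' : d < r / 2 := not_le.1 hdr
      have h1 : ρ ^ (-β) ≤ (r / 2) ^ (-β) :=
        Real.rpow_le_rpow_of_nonpos (by linarith) (by linarith) (by linarith)
      rw [half] at h1
      have h3 : r ^ (-β) * d ^ (-α) ≤ r ^ (-α) * prof α β d := by
        by_cases hd1 : d < 1
        · have : prof α β d = d ^ (-α) := by simp [prof, hd1]
          rw [this]
          exact mul_le_mul_of_nonneg_right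
            (Real.rpow_le_rpow_of_exponent_le hr1' (by linarith)) hdn
        · have : prof α β d = d ^ (-β) := by simp [prof, hd1]
          rw [this]
          have hd0 : 0 < d := by linarith [not_lt.1 hd1]
          have e1 : r ^ (-β) = r ^ (-α) * r ^ (-(β - α)) := by
            rw [← Real.rpow_add hr0]; ring_nf
          have e2 : d ^ (-β) = d ^ (-(β - α)) * d ^ (-α) := by
            rw [← Real.rpow_add hd0]; ring_nf
          have : r ^ (-(β - α)) ≤ d ^ (-(β - α)) :=
            Real.rpow_le_rpow_of_nonpos hd0 (by linarith) (by linarith)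
          rw [e1, e2, mul_assoc]
          gcongr
      calc ρ ^ (-β) * d ^ (-α) ≤ T * r ^ (-β) * d ^ (-α) := mul_le_mul_of_nonneg_right h1 hdn
        _ = T * (r ^ (-β) * d ^ (-α)) := by ring
        _ ≤ T * (r ^ (-α) * prof α β d) := by gcongr
        _ ≤ T * D * r ^ (-α) * (prof α β d + prof α β ρ) := by
            have h5 : 0 ≤ T * (r ^ (-α) * prof α β d) := by positivity
            have : 0 ≤ T * D * r ^ (-α) * prof α β ρ := by positivity
            nlinarith

lemma bubble_nonneg {μ : ℝ} (hμ : 0 < μ) (ξ x : E3) : 0 ≤ bubble μ ξ x := by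
  unfold bubble; positivity

lemma bubble_far {μ β : ℝ} (hμ : 0 < μ) (hβ : 0 < β) (ξ y : E3) (hy : 0 < ‖y - ξ‖) :
    bubble μ ξ y ^ β ≤ 3 ^ (β / 4) * μ ^ (β / 2) * ‖y - ξ‖ ^ (-β) := by
  have h : bubble μ ξ y ≤ 3 ^ ((1:ℝ)/4) * (μ / ‖y - ξ‖ ^ 2) ^ ((1:ℝ)/2) := by
    unfold bubble; gcongr; nlinarith [sq_nonneg μ]
  refine (Real.rpow_le_rpow (bubble_nonneg hμ ξ y) h hβ.le).trans (le_of_eq ?_)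
  rw [Real.mul_rpow (by positivity) (by positivity), ← Real.rpow_mul (by norm_num),
    ← Real.rpow_mul (by positivity), Real.div_rpow hμ.le (by positivity),
    ← Real.rpow_natCast, ← Real.rpow_mul hy.le, Real.rpow_neg hy.le]
  rw [show (1:ℝ)/4 * β = β/4 by ring, show (1:ℝ)/2 * β = β / 2 by ring,
    show ((2:ℕ):ℝ) * (β / 2) = β by push_cast; ring]
  ring

lemma bubble_near {μ γ : ℝ} (hμ : 0 < μ) (hγ : 0 < γ) (ξ x : E3) (hx : 0 < ‖x - ξ‖) :
    bubble μ ξ x ^ γ ≤ 3 ^ (γ / 4) * ‖x - ξ‖ ^ (-(γ / 2)) := by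
  have h : bubble μ ξ x ≤ 3 ^ ((1:ℝ)/4) * (‖x - ξ‖⁻¹) ^ ((1:ℝ)/2) := by
    unfold bubble; gcongr
    rw [← one_div, div_le_div_iff₀ (by positivity) hx]
    nlinarith [sq_nonneg (μ - ‖x - ξ‖), mul_pos hμ hx]
  refine (Real.rpow_le_rpow (bubble_nonneg hμ ξ x) h hγ.le).trans (le_of_eq ?_)
  rw [Real.mul_rpow (by positivity) (by positivity), ← Real.rpow_mul (by norm_num),
    ← Real.rpow_mul (by positivity), Real.inv_rpow hx.le, Real.rpow_neg hx.le]
  rw [show (1:ℝ)/4 * γ = γ/4 by ring, show (1:ℝ)/2 * γ = γ / 2 by ring]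

/-- let `α ∈ (0,3)`, `δ > 0`. There is `C = C(α,δ) > 0` such that for every open
`Ω ⊆ ℝ³`, every `ξ` with `B(ξ,δ) ⊆ Ω`, every `μ ∈ (0,1]` and every smooth compactly
supported `φ`,
`|∫_Ω ∫_{ℝ³∖Ω} w_{μ,ξ}(y)^{6−α} w_{μ,ξ}(x)^{5−α} φ(x) |x−y|^{−α} dy dx|
  ≤ C μ^{(6−α)/2} (∫ |∇φ|²)^{1/2}`. -/
theorem exterior_interaction_estimate (α δ : ℝ) (hα : α ∈ Set.Ioo (0 : ℝ) 3) (hδ : 0 < δ) :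
    ∃ C > 0, ∀ Ω : Set E3, IsOpen Ω → ∀ ξ : E3, Metric.ball ξ δ ⊆ Ω →
      ∀ μ ∈ Set.Ioc (0 : ℝ) 1, ∀ φ : E3 → ℝ, ContDiff ℝ (⊤ : ℕ∞) φ → HasCompactSupport φ →
        |∫ x in Ω, ∫ y in Ωᶜ,
            (bubble μ ξ y) ^ (6 - α) * (bubble μ ξ x) ^ (5 - α) * φ x / ‖x - y‖ ^ α|
          ≤ C * μ ^ ((6 - α) / 2) * (∫ x : E3, ‖fderiv ℝ φ x‖ ^ 2) ^ ((1 : ℝ)/2) := by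
  obtain ⟨hα0, hα3⟩ := hα
  obtain ⟨S, hS0, hS⟩ := sobolev6
  set δ' := min δ 1 with hδ'
  have hδ'0 : 0 < δ' := lt_min hδ one_pos
  have hδ'1 : δ' ≤ 1 := min_le_right _ _
  set J := ∫ z : E3, prof α (6 - α) ‖z‖ with hJ
  have hJi : Integrable (fun z : E3 => prof α (6 - α) ‖z‖) := prof_integrable hα3 (by linarith)
  have hJ0 : 0 ≤ J := integral_nonneg fun z => prof_nonneg _ _ (norm_nonneg _)
  set M := ∫ z : E3, prof (3 - 3 * α / 5) (3 + 3 * α / 5) ‖z‖ with hM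
  have hMi : Integrable (fun z : E3 => prof (3 - 3 * α / 5) (3 + 3 * α / 5) ‖z‖) :=
    prof_integrable (by linarith) (by linarith)
  have hM0 : 0 ≤ M := integral_nonneg fun z => prof_nonneg _ _ (norm_nonneg _)
  set A := (3:ℝ) ^ ((6 - α) / 4) * 3 ^ ((5 - α) / 4) * (2 ^ (6 - α) * δ' ^ (-(6 - α))) * (J + J)
    with hA
  have hA0 : 0 ≤ A := by positivity
  set γ := (5 - α) / 2 with hγ
  let K : ℝ → ℝ := fun t => t ^ (-γ) * prof 0 α t
  have hK0 : ∀ t, 0 ≤ t → 0 ≤ K t := fun t ht =>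
    mul_nonneg (Real.rpow_nonneg ht _) (prof_nonneg _ _ ht)
  have hKm : Measurable K := (by fun_prop : Measurable fun t : ℝ => t ^ (-γ)).mul (prof_meas 0 α)
  have hKpow : ∀ t, 0 ≤ t → K t ^ ((6:ℝ)/5) = prof (3 - 3 * α / 5) (3 + 3 * α / 5) t := by
    intro t ht
    simp only [K, prof]
    split_ifs with h
    · rw [neg_zero, Real.rpow_zero, mul_one, ← Real.rpow_mul ht]
      congr 1; rw [hγ]; ring
    · rw [← Real.rpow_add (by linarith), ← Real.rpow_mul ht]
      congr 1; rw [hγ]; ring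
  refine ⟨A * (S * M ^ (1 / ((6:ℝ)/5))) + 1, by positivity, ?_⟩
  intro Ω hΩ ξ hball μ hμ φ hφ hφc
  obtain ⟨hμ0, hμ1⟩ := hμ
  -- Hölder
  have hpq : (6:ℝ).HolderConjugate ((6:ℝ)/5) := by
    rw [Real.holderConjugate_iff]; norm_num
  have mφ : MemLp (fun x => |φ x|) (ENNReal.ofReal 6) (volume : Measure E3) :=
    (hφ.continuous.abs).memLp_of_hasCompactSupport (hφc.comp_left abs_zero)
  have mK : MemLp (fun x : E3 => K ‖x - ξ‖) (ENNReal.ofReal (6/5)) (volume : Measure E3) := by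
    have hmeas : Measurable (fun x : E3 => K ‖x - ξ‖) := hKm.comp (by fun_prop)
    rw [← integrable_norm_rpow_iff hmeas.aestronglyMeasurable (by norm_num) (by simp)]
    refine (hMi.comp_sub_right ξ).congr (Eventually.of_forall fun x => ?_)
    simp only
    rw [ENNReal.toReal_ofReal (by norm_num), Real.norm_of_nonneg (hK0 _ (norm_nonneg _)),
      hKpow _ (norm_nonneg _)]
  have hold := integral_mul_le_Lp_mul_Lq_of_nonneg hpq
    (Eventually.of_forall fun x => abs_nonneg (φ x))
    (Eventually.of_forall fun x : E3 => hK0 _ (norm_nonneg (x - ξ))) mφ mK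
  have hKint : ∫ x : E3, K ‖x - ξ‖ ^ ((6:ℝ)/5) = M := by
    rw [hM, ← integral_sub_right_eq_self
      (fun z : E3 => prof (3 - 3 * α / 5) (3 + 3 * α / 5) ‖z‖) ξ]
    exact integral_congr_ae (Eventually.of_forall fun x => hKpow _ (norm_nonneg _))
  rw [hKint] at hold
  have hconj : ENNReal.HolderConjugate (ENNReal.ofReal 6) (ENNReal.ofReal (6/5)) :=
    hpq.ennrealOfReal
  have hint : Integrable (fun x : E3 => |φ x| * K ‖x - ξ‖) := MemLp.integrable_mul mφ mK
  have hB : Integrable (fun x : E3 => (A * μ ^ ((6 - α) / 2)) * (|φ x| * K ‖x - ξ‖)) :=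
    hint.const_mul _
  have hBnn : ∀ x : E3, 0 ≤ (A * μ ^ ((6 - α) / 2)) * (|φ x| * K ‖x - ξ‖) := fun x =>
    mul_nonneg (by positivity) (mul_nonneg (abs_nonneg _) (hK0 _ (norm_nonneg _)))
  -- inner bound
  have inner : ∀ x : E3, x ≠ ξ → ‖∫ y in Ωᶜ,
      (bubble μ ξ y) ^ (6 - α) * (bubble μ ξ x) ^ (5 - α) * φ x / ‖x - y‖ ^ α‖ ≤
      (A * μ ^ ((6 - α) / 2)) * (|φ x| * K ‖x - ξ‖) := by
    intro x hx
    have hx0 : 0 < ‖x - ξ‖ := norm_pos_iff.2 (sub_ne_zero.2 hx)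
    set c := (3:ℝ) ^ ((6 - α) / 4) * 3 ^ ((5 - α) / 4) * (2 ^ (6 - α) * δ' ^ (-(6 - α))) *
      μ ^ ((6 - α) / 2) * (|φ x| * K ‖x - ξ‖) with hc
    have hc0 : 0 ≤ c := mul_nonneg (by positivity)
      (mul_nonneg (abs_nonneg _) (hK0 _ (norm_nonneg _)))
    have i1 : Integrable (fun y : E3 => prof α (6 - α) ‖x - y‖) := hJi.comp_sub_left x
    have i2 : Integrable (fun y : E3 => prof α (6 - α) ‖y - ξ‖) := hJi.comp_sub_right ξ
    have i3 := (i1.add i2).const_mul c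
    have v1 : ∫ y : E3, prof α (6 - α) ‖x - y‖ = J :=
      integral_sub_left_eq_self (fun z : E3 => prof α (6 - α) ‖z‖) volume x
    have v2 : ∫ y : E3, prof α (6 - α) ‖y - ξ‖ = J :=
      integral_sub_right_eq_self (fun z : E3 => prof α (6 - α) ‖z‖) ξ
    have step : ‖∫ y in Ωᶜ,
      (bubble μ ξ y) ^ (6 - α) * (bubble μ ξ x) ^ (5 - α) * φ x / ‖x - y‖ ^ α‖ ≤
      ∫ y in Ωᶜ, c * (prof α (6 - α) ‖x - y‖ + prof α (6 - α) ‖y - ξ‖) := by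
      refine norm_integral_le_of_norm_le i3.integrableOn ?_
      refine ae_restrict_of_forall_mem hΩ.measurableSet.compl fun y hy => ?_
      have hyδ : δ ≤ ‖y - ξ‖ := by
        by_contra h
        exact hy (hball (by rw [Metric.mem_ball, dist_eq_norm]; exact not_le.1 h))
      have hyδ' : δ' ≤ ‖y - ξ‖ := (min_le_left _ _).trans hyδ
      have htri : ‖x - ξ‖ ≤ ‖y - ξ‖ + ‖x - y‖ := by
        have := norm_add_le (y - ξ) (x - y)
        rwa [show y - ξ + (x - y) = x - ξ by abel] at this
      have kb := kernel_bound hα0 hα3 hδ'0 hδ'1 (norm_nonneg (x - ξ)) hyδ' (norm_nonneg (x - y)) htri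
      have b1 := bubble_far hμ0 (by linarith : 0 < 6 - α) ξ y (by linarith)
      have b2 := bubble_near hμ0 (by linarith : 0 < 5 - α) ξ x hx0
      have n1 : 0 ≤ bubble μ ξ y ^ (6 - α) := Real.rpow_nonneg (bubble_nonneg hμ0 _ _) _
      have n2 : 0 ≤ bubble μ ξ x ^ (5 - α) := Real.rpow_nonneg (bubble_nonneg hμ0 _ _) _
      rw [norm_div, norm_mul, norm_mul, Real.norm_of_nonneg n1, Real.norm_of_nonneg n2,
        Real.norm_of_nonneg (by positivity : 0 ≤ ‖x - y‖ ^ α), Real.norm_eq_abs, div_eq_mul_inv,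
        ← Real.rpow_neg (norm_nonneg _)]
      calc bubble μ ξ y ^ (6 - α) * bubble μ ξ x ^ (5 - α) * |φ x| * ‖x - y‖ ^ (-α)
          ≤ (3 ^ ((6 - α) / 4) * μ ^ ((6 - α) / 2) * ‖y - ξ‖ ^ (-(6 - α))) *
            (3 ^ ((5 - α) / 4) * ‖x - ξ‖ ^ (-γ)) * |φ x| * ‖x - y‖ ^ (-α) := by gcongr
        _ = (3 ^ ((6 - α) / 4) * μ ^ ((6 - α) / 2) * 3 ^ ((5 - α) / 4) * ‖x - ξ‖ ^ (-γ) * |φ x|) *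
            (‖y - ξ‖ ^ (-(6 - α)) * ‖x - y‖ ^ (-α)) := by ring
        _ ≤ _ := mul_le_mul_of_nonneg_left kb (by positivity)
        _ = c * (prof α (6 - α) ‖x - y‖ + prof α (6 - α) ‖y - ξ‖) := by
            rw [hc]; simp only [K]; ring
    refine step.trans ?_
    have le : ∫ y in Ωᶜ, c * (prof α (6 - α) ‖x - y‖ + prof α (6 - α) ‖y - ξ‖) ≤
        ∫ y, c * (prof α (6 - α) ‖x - y‖ + prof α (6 - α) ‖y - ξ‖) :=
      setIntegral_le_integral i3 (Eventually.of_forall fun y => mul_nonneg hc0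
        (add_nonneg (prof_nonneg _ _ (norm_nonneg _)) (prof_nonneg _ _ (norm_nonneg _))))
    refine le.trans (le_of_eq ?_)
    rw [integral_const_mul, integral_add i1 i2, v1, v2, hc, hA]
    ring
  have outer := norm_integral_le_of_norm_le (μ := volume.restrict Ω) (f := fun x => ∫ y in Ωᶜ,
      (bubble μ ξ y) ^ (6 - α) * (bubble μ ξ x) ^ (5 - α) * φ x / ‖x - y‖ ^ α) hB.integrableOn
      (by
        have : ∀ᵐ x : E3, x ≠ ξ := by
          rw [ae_iff]; simp
        exact (ae_restrict_of_ae this).mono inner)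
  rw [← Real.norm_eq_abs]
  refine outer.trans ((setIntegral_le_integral hB (Eventually.of_forall hBnn)).trans ?_)
  rw [integral_const_mul]
  have hs := hS φ hφ hφc
  set G := (∫ x : E3, ‖fderiv ℝ φ x‖ ^ 2) ^ ((1 : ℝ)/2) with hG
  have hG0 : 0 ≤ G := Real.rpow_nonneg (integral_nonneg fun x => by positivity) _
  calc A * μ ^ ((6 - α) / 2) * ∫ x : E3, |φ x| * K ‖x - ξ‖
      ≤ A * μ ^ ((6 - α) / 2) * ((S * G) * M ^ (1 / ((6:ℝ)/5))) := by
        refine mul_le_mul_of_nonneg_left (hold.trans ?_) (by positivity)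
        exact mul_le_mul_of_nonneg_right hs (by positivity)
    _ ≤ (A * (S * M ^ (1 / ((6:ℝ)/5))) + 1) * μ ^ ((6 - α) / 2) * G := by
        have : 0 ≤ μ ^ ((6 - α) / 2) * G := by positivity
        nlinarith

end
end
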